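/- Entropy is preserved (Corollary 3): Let f, g : ℝ × ℝ² → ℝ be smooth functions that are ℤ²-periodic in the phase-space variable (i.e., f(t,q+1,p) = f(t,q,p) = f(t,q,p+1) and likewise for g), with f(t,x) > 0 for all (t,x), and suppose ∂f/∂t(t,x) = [f(t,·), g(t,·)](x) for all (t,x). Then the entropy functional S(t) = ∫_{[0,1]²} f(t,x)·log f(t,x) dx is constant in t, for any choice of g (in particular for g = δH/δf − [μ(f), δE/δf] arising from the dissipative Vlasov equation with any energy functional E). -/

import Mathlib

/-- Partial derivative with respect to the first coordinate `q` on phase space `ℝ × ℝ`. -/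
noncomputable def pdq (f : ℝ × ℝ → ℝ) (x : ℝ × ℝ) : ℝ :=
  deriv (fun q => f (q, x.2)) x.1

/-- Partial derivative with respect to the second coordinate `p` on phase space `ℝ × ℝ`. -/
noncomputable def pdp (f : ℝ × ℝ → ℝ) (x : ℝ × ℝ) : ℝ :=
  deriv (fun p => f (x.1, p)) x.2

/-- Canonical Poisson bracket `[f,g] = ∂f/∂q·∂g/∂p − ∂f/∂p·∂g/∂q` on `ℝ × ℝ`. -/
noncomputable def pb (f g : ℝ × ℝ → ℝ) (x : ℝ × ℝ) : ℝ :=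
  pdq f x * pdp g x - pdp f x * pdq g x

theorem pdq_eq_fderiv {f : ℝ × ℝ → ℝ} {x : ℝ × ℝ} (hf : DifferentiableAt ℝ f x) :
    pdq f x = fderiv ℝ f x (1, 0) :=
  (HasFDerivAt.comp_hasDerivAt (f := fun q => (q, x.2)) x.1 hf.hasFDerivAt
    ((hasDerivAt_id x.1).prodMk (hasDerivAt_const x.1 x.2))).deriv

theorem pdp_eq_fderiv {f : ℝ × ℝ → ℝ} {x : ℝ × ℝ} (hf : DifferentiableAt ℝ f x) :
    pdp f x = fderiv ℝ f x (0, 1) :=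
  (HasFDerivAt.comp_hasDerivAt (f := fun p => (x.1, p)) x.2 hf.hasFDerivAt
    ((hasDerivAt_const x.2 x.1).prodMk (hasDerivAt_id x.2))).deriv

/-- Chain rule for the Poisson bracket in its first argument. -/
theorem pb_comp_left {φ : ℝ → ℝ} {φ' : ℝ} {f : ℝ × ℝ → ℝ} {x : ℝ × ℝ}
    (hφ : HasDerivAt φ φ' (f x)) (hf : DifferentiableAt ℝ f x) (g : ℝ × ℝ → ℝ) :
    pb (fun y => φ (f y)) g x = φ' * pb f g x := by
  have h : HasFDerivAt (fun y => φ (f y)) (φ' • fderiv ℝ f x) x :=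
    hφ.comp_hasFDerivAt x hf.hasFDerivAt
  simp only [pb, pdq_eq_fderiv h.differentiableAt, pdp_eq_fderiv h.differentiableAt, h.fderiv,
    pdq_eq_fderiv hf, pdp_eq_fderiv hf, smul_apply, smul_eq_mul]
  ring

/-- The Poisson bracket of two functions on the torus has mean zero. -/
theorem integral_pb_eq_zero {h g : ℝ × ℝ → ℝ} (hh : ContDiff ℝ 1 h) (hg : ContDiff ℝ 2 g)
    (hhq : ∀ p, h (1, p) = h (0, p)) (hhp : ∀ q, h (q, 1) = h (q, 0))
    (hgq : ∀ p, g (1, p) = g (0, p)) (hgp : ∀ q, g (q, 1) = g (q, 0)) :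
    ∫ x in Set.Icc (0 : ℝ) 1 ×ˢ Set.Icc (0 : ℝ) 1, pb h g x = 0 := by
  have dh : Differentiable ℝ h := hh.differentiable one_ne_zero
  have dg : Differentiable ℝ g := hg.differentiable two_ne_zero
  have hg' : ContDiff ℝ 1 (fderiv ℝ g) := hg.fderiv_right (by norm_num)
  have dg' : Differentiable ℝ (fderiv ℝ g) := hg'.differentiable one_ne_zero
  have hF (v : ℝ × ℝ) (x : ℝ × ℝ) : HasFDerivAt (fun y => h y * fderiv ℝ g y v)
      (h x • (fderiv ℝ (fderiv ℝ g) x).flip v + fderiv ℝ g x v • fderiv ℝ h x) x := by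
    refine (dh x).hasFDerivAt.mul ?_
    exact ((ContinuousLinearMap.apply ℝ ℝ v).hasFDerivAt).comp x (dg' x).hasFDerivAt
  have hF_cont (v : ℝ × ℝ) : Continuous fun y => h y * fderiv ℝ g y v :=
    hh.continuous.mul (hg'.continuous.clm_apply continuous_const)
  have hpb (x : ℝ × ℝ) : pb h g x =
      (h x • (fderiv ℝ (fderiv ℝ g) x).flip (0, 1) + fderiv ℝ g x (0, 1) • fderiv ℝ h x) (1, 0) +
      (-(h x • (fderiv ℝ (fderiv ℝ g) x).flip (1, 0) + fderiv ℝ g x (1, 0) • fderiv ℝ h x))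
        (0, 1) := by
    have hsymm : IsSymmSndFDerivAt ℝ g x := hg.contDiffAt.isSymmSndFDerivAt (by simp)
    have := hsymm (1, 0) (0, 1)
    simp only [pb, pdq_eq_fderiv (dh x), pdp_eq_fderiv (dh x), pdq_eq_fderiv (dg x),
      pdp_eq_fderiv (dg x), add_apply, neg_apply, smul_apply, smul_eq_mul,
      ContinuousLinearMap.flip_apply, this]
    ring
  have hpb_cont : Continuous (pb h g) := by
    have hh' := hh.continuous_fderiv one_ne_zero
    have : pb h g = fun x => fderiv ℝ h x (1, 0) * fderiv ℝ g x (0, 1)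
        - fderiv ℝ h x (0, 1) * fderiv ℝ g x (1, 0) := by
      ext x
      simp only [pb, pdq_eq_fderiv (dh x), pdp_eq_fderiv (dh x), pdq_eq_fderiv (dg x),
        pdp_eq_fderiv (dg x)]
    rw [this]
    have hg'' := hg'.continuous
    fun_prop
  have key := MeasureTheory.integral_divergence_prod_Icc_of_hasFDerivAt_of_le
    _ _ _ _ ((0 : ℝ), (0 : ℝ)) (1, 1) (by simp)
    (hF_cont (0, 1)).continuousOn (hF_cont (1, 0)).neg.continuousOn
    (fun x _ => hF (0, 1) x) (fun x _ => (hF (1, 0) x).neg) (by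
      simp only [← hpb]
      exact hpb_cont.continuousOn.integrableOn_compact isCompact_Icc)
  simp only [← hpb] at key
  rw [Set.Icc_prod_Icc, key]
  have hq (p : ℝ) : pdp g (1, p) = pdp g (0, p) := by simp only [pdp, hgq]
  have hp (q : ℝ) : pdq g (q, 1) = pdq g (q, 0) := by simp only [pdq, hgp]
  simp only [← pdq_eq_fderiv (dg _), ← pdp_eq_fderiv (dg _), hq, hp, hhq, hhp, Pi.neg_apply]
  ring

/-- Differentiation under the integral sign over a compact set. -/
theorem hasDerivAt_setIntegral_of_contDiff {F : ℝ × (ℝ × ℝ) → ℝ} (hF : ContDiff ℝ 1 F)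
    {K : Set (ℝ × ℝ)} (hK : IsCompact K) (t : ℝ) :
    HasDerivAt (fun s => ∫ x in K, F (s, x)) (∫ x in K, deriv (fun s => F (s, x)) t) t := by
  have hderiv (s : ℝ) (x : ℝ × ℝ) :
      HasDerivAt (fun r => F (r, x)) (fderiv ℝ F (s, x) (1, 0)) s :=
    HasFDerivAt.comp_hasDerivAt (f := fun r => (r, x)) s
      (hF.differentiable one_ne_zero (s, x)).hasFDerivAt
      ((hasDerivAt_id s).prodMk (hasDerivAt_const s x))
  have hF' : Continuous fun z => fderiv ℝ F z (1, 0) :=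
    (hF.continuous_fderiv one_ne_zero).clm_apply continuous_const
  obtain ⟨C, hC⟩ := ((isCompact_Icc (a := t - 1) (b := t + 1)).prod hK).exists_bound_of_continuousOn
    hF'.continuousOn
  simp only [fun x => (hderiv t x).deriv]
  have hslice (s : ℝ) : Continuous fun x => F (s, x) := hF.continuous.comp (by fun_prop)
  have hslice' : Continuous fun x => fderiv ℝ F (t, x) (1, 0) :=
    hF'.comp (g := fun z => fderiv ℝ F z (1, 0)) (f := fun x => (t, x)) (by fun_prop)
  refine (hasDerivAt_integral_of_dominated_loc_of_deriv_le (F := fun s x => F (s, x))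
    (F' := fun s x => fderiv ℝ F (s, x) (1, 0)) (bound := fun _ => C)
    (Icc_mem_nhds (sub_one_lt t) (lt_add_one t)) ?_ ?_ ?_ ?_ ?_ ?_).2
  · exact .of_forall fun s => (hslice s).aestronglyMeasurable
  · exact (hslice t).continuousOn.integrableOn_compact hK
  · exact hslice'.aestronglyMeasurable
  · exact MeasureTheory.ae_restrict_of_forall_mem hK.measurableSet
      fun x hx s hs => hC (s, x) ⟨hs, hx⟩
  · exact continuousOn_const.integrableOn_compact hK
  · exact .of_forall fun x s _ => hderiv s x

/-- Entropy preservation on the torus: for smooth, ℤ²-periodic, positive `f` evolving by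
`∂f/∂t = [f, g]` with `g` smooth and ℤ²-periodic, the entropy
`S(t) = ∫_{[0,1]²} f log f` is constant. -/
theorem entropy_preserved (f g : ℝ × (ℝ × ℝ) → ℝ)
    (hf : ContDiff ℝ (⊤ : ℕ∞) f) (hg : ContDiff ℝ (⊤ : ℕ∞) g)
    (hfper : ∀ (t q p : ℝ), f (t, (q + 1, p)) = f (t, (q, p)) ∧ f (t, (q, p + 1)) = f (t, (q, p)))
    (hgper : ∀ (t q p : ℝ), g (t, (q + 1, p)) = g (t, (q, p)) ∧ g (t, (q, p + 1)) = g (t, (q, p)))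
    (hfpos : ∀ (t : ℝ) (x : ℝ × ℝ), 0 < f (t, x))
    (heq : ∀ (t : ℝ) (x : ℝ × ℝ),
      deriv (fun s => f (s, x)) t = pb (fun y => f (t, y)) (fun y => g (t, y)) x) :
    ∀ t₁ t₂ : ℝ,
      (∫ x in Set.Icc (0:ℝ) 1 ×ˢ Set.Icc (0:ℝ) 1, f (t₁, x) * Real.log (f (t₁, x)))
        = ∫ x in Set.Icc (0:ℝ) 1 ×ˢ Set.Icc (0:ℝ) 1, f (t₂, x) * Real.log (f (t₂, x)) := by
  have hf1 : ContDiff ℝ 2 f := contDiff_infty.1 hf 2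
  have hg2 : ContDiff ℝ 2 g := contDiff_infty.1 hg 2
  have hF : ContDiff ℝ 1 fun z => f z * Real.log (f z) :=
    (hf1.mul (hf1.log fun z => (hfpos z.1 z.2).ne')).of_le one_le_two
  have hslice (t : ℝ) : ContDiff ℝ 2 fun x : ℝ × ℝ => (t, x) := contDiff_prodMk_right t
  have hder (t : ℝ) (x : ℝ × ℝ) : deriv (fun s => f (s, x) * Real.log (f (s, x))) t =
      pb (fun y => f (t, y) * Real.log (f (t, y))) (fun y => g (t, y)) x := by
    have hφ := Real.hasDerivAt_mul_log (hfpos t x).ne'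
    have hft : DifferentiableAt ℝ (fun s => f (s, x)) t :=
      (hf1.comp (contDiff_prodMk_left x)).differentiable two_ne_zero t
    rw [pb_comp_left (φ := fun r => r * Real.log r) (f := fun y => f (t, y)) hφ
      ((hf1.comp (hslice t)).differentiable two_ne_zero x), ← heq]
    exact (hφ.comp t hft.hasDerivAt).deriv
  have hS (t : ℝ) := hasDerivAt_setIntegral_of_contDiff hF
    ((isCompact_Icc (a := (0 : ℝ)) (b := 1)).prod (isCompact_Icc (a := (0 : ℝ)) (b := 1))) t
  refine is_const_of_deriv_eq_zero (fun t => (hS t).differentiableAt) fun t => ?_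
  have hfq (p : ℝ) : f (t, 1, p) = f (t, 0, p) := by simpa using (hfper t 0 p).1
  have hfp (q : ℝ) : f (t, q, 1) = f (t, q, 0) := by simpa using (hfper t q 0).2
  rw [(hS t).deriv]
  simp only [hder]
  refine integral_pb_eq_zero (hF.comp ((hslice t).of_le one_le_two)) (hg2.comp (hslice t))
    (fun p => ?_) (fun q => ?_) (fun p => ?_) fun q => ?_
  · simp only [hfq]
  · simp only [hfp]
  · simpa using (hgper t 0 p).1
  · simpa using (hgper t q 0).2
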